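/- (Relative entropy estimate, part (II), relative temperature bound.) Let ê : ℝ¹⁹×[0,∞) → ℝ (with ξ = (F,ζ,w) ∈ M₃(ℝ)×M₃(ℝ)×ℝ) be C³, uniformly convex (∇²_{(ξ,η)}ê ≥ c𝕀 for some c > 0), and satisfy the growth conditions (G1)–(G3) with exponents p ≥ 4, q ≥ 2, ρ > 1, ℓ > 1, and set θ̂ := ∂_η ê. Then for every M > 0 there is a constant C₃ > 0 such that for all (F,v,η) ∈ M₃(ℝ)×ℝ³×[0,∞) and all (F̄,v̄,η̄) ∈ Γ_M: | θ̂(Φ(F),η | Φ(F̄),η̄) | ≤ C₃ · I(v,Φ(F),η | v̄,Φ(F̄),η̄), where θ̂(ξ,η|ξ̄,η̄) := θ̂(ξ,η) − θ̂(ξ̄,η̄) − ∇_ξ θ̂(ξ̄,η̄)·(ξ−ξ̄) − ∂_η θ̂(ξ̄,η̄)(η−η̄). -/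

import Mathlib

open scoped BigOperators
noncomputable section

/-- 3×3 real matrices, modelled as `Fin 3 → Fin 3 → ℝ`. -/
abbrev Mat : Type := Fin 3 → Fin 3 → ℝ

/-- The Levi-Civita symbol on `{0,1,2}`. -/
def lc (i j k : Fin 3) : ℝ :=
  (((j : ℕ) : ℝ) - ((i : ℕ) : ℝ)) * (((k : ℕ) : ℝ) - ((i : ℕ) : ℝ)) *
    (((k : ℕ) : ℝ) - ((j : ℕ) : ℝ)) / 2

/-- The cofactor matrix `(cof F)_{iα} = (1/2) Σ ε_{ijk} ε_{αβγ} F_{jβ} F_{kγ}`. -/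
def cof (F : Mat) : Mat := fun i α =>
  (1 / 2) * ∑ j, ∑ k, ∑ β, ∑ γ, lc i j k * lc α β γ * F j β * F k γ

/-- The determinant `det F = (1/6) Σ ε_{ijk} ε_{αβγ} F_{iα} F_{jβ} F_{kγ}`. -/
def mdet (F : Mat) : ℝ :=
  (1 / 6) * ∑ i, ∑ j, ∑ k, ∑ α, ∑ β, ∑ γ, lc i j k * lc α β γ * F i α * F j β * F k γ

/-- Frobenius norm of a 3×3 matrix. -/
def frob (F : Mat) : ℝ := Real.sqrt (∑ i, ∑ j, F i j ^ 2)

/-- The extended state space `ξ = (F, ζ, w) ∈ M₃(ℝ) × M₃(ℝ) × ℝ ≅ ℝ¹⁹`. -/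
abbrev Xi : Type := Mat × Mat × ℝ

/-- Extended state together with the entropy: `(ξ, η) ∈ ℝ¹⁹ × ℝ`. -/
abbrev XE : Type := Xi × ℝ

/-- The natural domain `{η ≥ 0}` of the internal energy. -/
def Dom : Set XE := {x | 0 ≤ x.2}

/-- The null-Lagrangian vector `Φ(F) = (F, cof F, det F)`. -/
def Phi (F : Mat) : Xi := (F, cof F, mdet F)

/-- Directional derivative of `eh` at `x` in the pure-`ξ` direction `d`
(equivalently `Σ_B (∂eh/∂ξ^B)(x) d^B`), taken within the domain `{η ≥ 0}`. -/
def dXi (eh : XE → ℝ) (x : XE) (d : Xi) : ℝ :=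
  fderivWithin ℝ eh Dom x (d, 0)

/-- `θ̂ = ∂eh/∂η`, taken within the domain `{η ≥ 0}`. -/
def dEta (eh : XE → ℝ) (x : XE) : ℝ :=
  fderivWithin ℝ eh Dom x (0, 1)

/-- Matrix of partial derivatives `∂eh/∂F`. -/
def dFmat (eh : XE → ℝ) (x : XE) : Mat :=
  fun i j => dXi eh x (Pi.single i (Pi.single j 1), 0, 0)

/-- Matrix of partial derivatives `∂eh/∂ζ`. -/
def dZmat (eh : XE → ℝ) (x : XE) : Mat :=
  fun i j => dXi eh x (0, Pi.single i (Pi.single j 1), 0)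

/-- Partial derivative `∂eh/∂w`. -/
def dW (eh : XE → ℝ) (x : XE) : ℝ := dXi eh x (0, 0, 1)

/-- Second directional derivative of `eh` at `x`, in directions `u` (outer) and
`d` (inner), within the domain `{η ≥ 0}`. -/
def d2 (eh : XE → ℝ) (x : XE) (u d : XE) : ℝ :=
  fderivWithin ℝ (fun y => fderivWithin ℝ eh Dom y d) Dom x u

/-- The weight `|F|^p + |ζ|^q + |w|^ρ + |η|^ℓ` appearing in the growth conditions. -/
def bigN (p q ρ ℓ : ℝ) (x : XE) : ℝ :=
  frob x.1.1 ^ p + frob x.1.2.1 ^ q + |x.1.2.2| ^ ρ + |x.2| ^ ℓ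

/-- Uniform convexity `∇²_{(ξ,η)} eh ≥ c 𝕀` (as quadratic forms, with the Euclidean
norm on `ℝ¹⁹ × ℝ`). -/
def UnifConvex (eh : XE → ℝ) (c : ℝ) : Prop :=
  ∀ x ∈ Dom, ∀ d : XE,
    c * (frob d.1.1 ^ 2 + frob d.1.2.1 ^ 2 + d.1.2.2 ^ 2 + d.2 ^ 2) ≤ d2 eh x d d

/-- Growth condition (G1): `c N(ξ,η) - c ≤ eh(ξ,η) ≤ c N(ξ,η) + c`. -/
def GrowthG1 (eh : XE → ℝ) (c p q ρ ℓ : ℝ) : Prop :=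
  ∀ x ∈ Dom, c * bigN p q ρ ℓ x - c ≤ eh x ∧ eh x ≤ c * bigN p q ρ ℓ x + c

/-- Growth condition (G2): `∂_η eh / N → 0` as `N → ∞`. -/
def GrowthG2 (eh : XE → ℝ) (p q ρ ℓ : ℝ) : Prop :=
  ∀ ε > (0:ℝ), ∃ R : ℝ, ∀ x ∈ Dom, R ≤ bigN p q ρ ℓ x → |dEta eh x| ≤ ε * bigN p q ρ ℓ x

/-- Growth condition (G3):
`|∂_F eh|^{p/(p-1)} + |∂_ζ eh|^{p/(p-2)} + |∂_w eh|^{p/(p-3)} ≤ c N + c`. -/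
def GrowthG3 (eh : XE → ℝ) (c p q ρ ℓ : ℝ) : Prop :=
  ∀ x ∈ Dom,
    frob (dFmat eh x) ^ (p / (p-1)) + frob (dZmat eh x) ^ (p / (p-2))
      + |dW eh x| ^ (p / (p-3)) ≤ c * bigN p q ρ ℓ x + c

/-- The relative internal energy
`eh(ξ,η | ξ̄,η̄) = eh(ξ,η) − eh(ξ̄,η̄) − ∇_ξ eh(ξ̄,η̄)·(ξ−ξ̄) − ∂_η eh(ξ̄,η̄)(η−η̄)`. -/
def erel (eh : XE → ℝ) (x xb : XE) : ℝ :=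
  eh x - eh xb - dXi eh xb (x.1 - xb.1) - dEta eh xb * (x.2 - xb.2)

/-- The relative total energy `I(v,ξ,η | v̄,ξ̄,η̄) = ½|v−v̄|² + eh(ξ,η|ξ̄,η̄)`. -/
def relI (eh : XE → ℝ) (v vb : Fin 3 → ℝ) (x xb : XE) : ℝ :=
  (1/2) * (∑ i, (v i - vb i)^2) + erel eh x xb

/-- The compact set `Γ_M = {(F̄,v̄,η̄) : |F̄| ≤ M, |v̄| ≤ M, 0 ≤ η̄ ≤ M}`. -/
def Gam (M : ℝ) (Fb : Mat) (vb : Fin 3 → ℝ) (ηb : ℝ) : Prop :=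
  frob Fb ≤ M ∧ Real.sqrt (∑ i, (vb i)^2) ≤ M ∧ 0 ≤ ηb ∧ ηb ≤ M

/-- `|Φ(F) − Φ(F̄)|²` (squared Euclidean distance of the null-Lagrangian vectors). -/
def phidist (F Fb : Mat) : ℝ :=
  frob (F - Fb) ^ 2 + frob (cof F - cof Fb) ^ 2 + (mdet F - mdet Fb) ^ 2

/-- The relative temperature
`θ̂(ξ,η|ξ̄,η̄) = θ̂(ξ,η) − θ̂(ξ̄,η̄) − ∇_ξ θ̂(ξ̄,η̄)·(ξ−ξ̄) − ∂_η θ̂(ξ̄,η̄)(η−η̄)`,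
where `θ̂ = ∂_η eh`. -/
def relTheta (eh : XE → ℝ) (x xb : XE) : ℝ :=
  dEta eh x - dEta eh xb
    - fderivWithin ℝ (fun y => dEta eh y) Dom xb (x.1 - xb.1, x.2 - xb.2)

/-- Second-order Taylor lower bound along a segment of a convex set. -/
lemma half_le_sub_sub_fderivWithin {E : Type*} [NormedAddCommGroup E] [NormedSpace ℝ E]
    {s : Set E} (hs : Convex ℝ s) (hu : UniqueDiffOn ℝ s) {f : E → ℝ}
    (hf : ContDiffOn ℝ 2 f s) {x y : E} (hx : x ∈ s) (hy : y ∈ s) {m : ℝ}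
    (hm : ∀ z ∈ s, m ≤ fderivWithin ℝ (fun w => fderivWithin ℝ f s w (x - y)) s z (x - y)) :
    m / 2 ≤ f x - f y - fderivWithin ℝ f s y (x - y) := by
  set d := x - y with hd
  have hmem : ∀ t ∈ Set.Icc (0 : ℝ) 1, y + t • d ∈ s := fun t ht =>
    hs.add_smul_sub_mem hy hx ht
  have hline : ∀ t : ℝ, HasDerivWithinAt (fun t : ℝ => y + t • d) d (Set.Icc 0 1) t := by
    intro t
    simpa using (((hasDerivAt_id t).smul_const d).const_add y).hasDerivWithinAt
  have hD : ContDiffOn ℝ 1 (fun w => fderivWithin ℝ f s w d) s :=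
    (hf.fderivWithin hu (by norm_num)).clm_apply contDiffOn_const
  have h1 : ∀ t ∈ Set.Icc (0 : ℝ) 1, HasDerivWithinAt (fun t : ℝ => f (y + t • d))
      (fderivWithin ℝ f s (y + t • d) d) (Set.Icc 0 1) t := fun t ht =>
    ((hf.differentiableOn (by norm_num)) _ (hmem t ht)).hasFDerivWithinAt.comp_hasDerivWithinAt
      t (hline t) hmem
  have h2 : ∀ t ∈ Set.Icc (0 : ℝ) 1,
      HasDerivWithinAt (fun t : ℝ => fderivWithin ℝ f s (y + t • d) d)
        (fderivWithin ℝ (fun w => fderivWithin ℝ f s w d) s (y + t • d) d) (Set.Icc 0 1) t := by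
    intro t ht
    have h := ((hD.differentiableOn one_ne_zero) _ (hmem t ht)).hasFDerivWithinAt
    exact h.comp_hasDerivWithinAt t (hline t) hmem
  have h3 : ∀ t ∈ Set.Icc (0 : ℝ) 1, HasDerivWithinAt
      (fun t : ℝ => fderivWithin ℝ f s (y + t • d) d - m * t)
        (fderivWithin ℝ (fun w => fderivWithin ℝ f s w d) s (y + t • d) d - m)
        (Set.Icc 0 1) t := fun t ht => by
    have h := (h2 t ht).sub ((hasDerivAt_id t).const_mul m).hasDerivWithinAt
    rw [mul_one] at h
    exact h
  have h4 : ∀ t ∈ Set.Icc (0 : ℝ) 1, HasDerivWithinAt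
      (fun t : ℝ => f (y + t • d) - (fderivWithin ℝ f s y d * t + m / 2 * t ^ 2))
        (fderivWithin ℝ f s (y + t • d) d - (fderivWithin ℝ f s y d + m * t))
        (Set.Icc 0 1) t := fun t ht => by
    refine (h1 t ht).sub (HasDerivAt.hasDerivWithinAt ?_)
    refine (((hasDerivAt_id t).const_mul (fderivWithin ℝ f s y d)).add
      (((hasDerivAt_id t).pow 2).const_mul (m / 2))).congr_deriv ?_
    simp only [id, Nat.cast_ofNat]
    ring
  have hmono := monotoneOn_of_hasDerivWithinAt_nonneg (convex_Icc (0 : ℝ) 1)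
    (fun t ht => (h3 t ht).continuousWithinAt)
    (fun t ht => (h3 t (interior_subset ht)).mono interior_subset)
    (fun t ht => sub_nonneg.2 (hm _ (hmem t (interior_subset ht))))
  have hmono' := monotoneOn_of_hasDerivWithinAt_nonneg (convex_Icc (0 : ℝ) 1)
    (fun t ht => (h4 t ht).continuousWithinAt)
    (fun t ht => (h4 t (interior_subset ht)).mono interior_subset)
    (fun t ht => by
      have ht' := interior_subset ht
      have := hmono (Set.left_mem_Icc.2 zero_le_one) ht' ht'.1
      simp only [zero_smul, add_zero, mul_zero, sub_zero] at this
      linarith)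
  have := hmono' (Set.left_mem_Icc.2 zero_le_one) (Set.right_mem_Icc.2 zero_le_one) zero_le_one
  have hx1 : y + d = x := add_sub_cancel y x
  simp only [zero_smul, add_zero, mul_zero, one_smul, mul_one, one_pow, hx1, sub_zero, ne_eq,
    OfNat.ofNat_ne_zero, not_false_eq_true, zero_pow] at this
  linarith

/-- Second-order Taylor upper bound on bounded parts of a closed convex set. -/
lemma exists_abs_sub_sub_fderivWithin_le {E : Type*} [NormedAddCommGroup E] [NormedSpace ℝ E]
    [ProperSpace E] {s : Set E} (hs : Convex ℝ s) (hu : UniqueDiffOn ℝ s) (hcl : IsClosed s)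
    {f : E → ℝ} (hf : ContDiffOn ℝ 2 f s) (r : ℝ) :
    ∃ C : ℝ, ∀ x ∈ s ∩ Metric.closedBall 0 r, ∀ y ∈ s ∩ Metric.closedBall 0 r,
      |f x - f y - fderivWithin ℝ f s y (x - y)| ≤ C * ‖x - y‖ ^ 2 := by
  have hD : ContDiffOn ℝ 1 (fderivWithin ℝ f s) s := hf.fderivWithin hu (by norm_num)
  have hk : IsCompact (s ∩ Metric.closedBall 0 r) :=
    (isCompact_closedBall (0 : E) r).inter_left hcl
  have hkc : Convex ℝ (s ∩ Metric.closedBall 0 r) := hs.inter (convex_closedBall _ _)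
  obtain ⟨C, hC⟩ := hk.exists_bound_of_continuousOn
    ((hD.continuousOn_fderivWithin hu le_rfl).mono Set.inter_subset_left)
  refine ⟨C, fun x hx y hy => ?_⟩
  have hC0 : 0 ≤ C := (norm_nonneg _).trans (hC x hx)
  have hseg := hkc.segment_subset hy hx
  have hlip : ∀ z ∈ segment ℝ y x, ‖fderivWithin ℝ f s z - fderivWithin ℝ f s y‖ ≤
      C * ‖x - y‖ := by
    intro z hz
    have h := hkc.norm_image_sub_le_of_norm_hasFDerivWithin_le
      (fun w hw => ((hD.differentiableOn (by norm_num)) w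
        hw.1).hasFDerivWithinAt.mono Set.inter_subset_left) hC hy (hseg hz)
    refine h.trans (mul_le_mul_of_nonneg_left ?_ hC0)
    obtain ⟨t, ht, rfl⟩ := (segment_eq_image' ℝ y x ▸ hz)
    rw [add_sub_cancel_left, norm_smul, Real.norm_of_nonneg ht.1]
    exact mul_le_of_le_one_left (norm_nonneg _) ht.2
  have h := (convex_segment y x).norm_image_sub_le_of_norm_hasFDerivWithin_le'
    (fun w hw => ((hf.differentiableOn (by norm_num)) w
      (hseg hw).1).hasFDerivWithinAt.mono fun _ hv => (hseg hv).1) hlip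
    (left_mem_segment ℝ y x) (right_mem_segment ℝ y x)
  rwa [mul_assoc, ← sq] at h

lemma convex_Dom : Convex ℝ Dom :=
  convex_halfSpace_ge (LinearMap.snd ℝ Xi ℝ).isLinear 0

lemma isClosed_Dom : IsClosed Dom := isClosed_le continuous_const continuous_snd

lemma uniqueDiffOn_Dom : UniqueDiffOn ℝ Dom := by
  refine uniqueDiffOn_convex convex_Dom ⟨((0 : Xi), (1 : ℝ)), ?_⟩
  exact mem_interior.2 ⟨{x : XE | 0 < x.2}, fun x (hx : 0 < x.2) => hx.le,
    isOpen_lt continuous_const continuous_snd, by simp⟩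

lemma norm_le_frob (F : Mat) : ‖F‖ ≤ frob F := by
  have h0 : 0 ≤ frob F := Real.sqrt_nonneg _
  refine (pi_norm_le_iff_of_nonneg h0).2 fun i => (pi_norm_le_iff_of_nonneg h0).2 fun j => ?_
  refine Real.abs_le_sqrt ?_
  calc F i j ^ 2 ≤ ∑ j, F i j ^ 2 :=
        Finset.single_le_sum (f := fun j => F i j ^ 2) (fun _ _ => sq_nonneg _)
          (Finset.mem_univ j)
    _ ≤ _ := Finset.single_le_sum (f := fun i => ∑ j, F i j ^ 2)
        (fun _ _ => Finset.sum_nonneg fun _ _ => sq_nonneg _) (Finset.mem_univ i)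

lemma norm_sq_le_euclidean (d : XE) :
    ‖d‖ ^ 2 ≤ frob d.1.1 ^ 2 + frob d.1.2.1 ^ 2 + d.1.2.2 ^ 2 + d.2 ^ 2 := by
  have hF := pow_le_pow_left₀ (norm_nonneg _) (norm_le_frob d.1.1) 2
  have hZ := pow_le_pow_left₀ (norm_nonneg _) (norm_le_frob d.1.2.1) 2
  have hw : ‖d.1.2.2‖ ^ 2 = d.1.2.2 ^ 2 := sq_abs _
  have hη : ‖d.2‖ ^ 2 = d.2 ^ 2 := sq_abs _
  have h1 := sq_nonneg (frob d.1.1)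
  have h2 := sq_nonneg (frob d.1.2.1)
  have h3 := sq_nonneg d.1.2.2
  have h4 := sq_nonneg d.2
  rw [Prod.norm_def, Prod.norm_def, Prod.norm_def]
  rcases max_choice (max ‖d.1.1‖ (max ‖d.1.2.1‖ ‖d.1.2.2‖)) ‖d.2‖ with h | h <;> rw [h]
  · rcases max_choice ‖d.1.1‖ (max ‖d.1.2.1‖ ‖d.1.2.2‖) with h | h <;> rw [h]
    · linarith
    · rcases max_choice ‖d.1.2.1‖ ‖d.1.2.2‖ with h | h <;> rw [h] <;> linarith
  · linarith

lemma le_max_one_of_rpow_le {t a R : ℝ} (ha : 1 ≤ a) (h : t ^ a ≤ R) : t ≤ max 1 R := by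
  rcases le_total t 1 with h1 | h1
  · exact h1.trans (le_max_left _ _)
  · exact ((Real.self_le_rpow_of_one_le h1 ha).trans h).trans (le_max_right _ _)

lemma norm_le_of_bigN_le {p q ρ ℓ R : ℝ} (hp : 1 ≤ p) (hq : 1 ≤ q) (hρ : 1 ≤ ρ) (hℓ : 1 ≤ ℓ)
    {x : XE} (h : bigN p q ρ ℓ x ≤ R) : ‖x‖ ≤ max 1 R := by
  unfold bigN at h
  have h1 : 0 ≤ frob x.1.1 ^ p := Real.rpow_nonneg (Real.sqrt_nonneg _) _
  have h2 : 0 ≤ frob x.1.2.1 ^ q := Real.rpow_nonneg (Real.sqrt_nonneg _) _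
  have h3 : 0 ≤ |x.1.2.2| ^ ρ := by positivity
  have h4 : 0 ≤ |x.2| ^ ℓ := by positivity
  refine norm_prod_le_iff.2 ⟨norm_prod_le_iff.2 ⟨?_, norm_prod_le_iff.2 ⟨?_, ?_⟩⟩, ?_⟩
  · exact (norm_le_frob _).trans (le_max_one_of_rpow_le hp (by linarith))
  · exact (norm_le_frob _).trans (le_max_one_of_rpow_le hq (by linarith))
  · exact le_max_one_of_rpow_le hρ (by rw [Real.norm_eq_abs]; linarith)
  · exact le_max_one_of_rpow_le hℓ (by rw [Real.norm_eq_abs]; linarith)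

lemma continuous_Phi : Continuous Phi := by
  unfold Phi cof mdet
  fun_prop

lemma exists_norm_Phi_le (M : ℝ) : ∃ r : ℝ, ∀ (F : Mat) (η : ℝ),
    frob F ≤ M → 0 ≤ η → η ≤ M → ‖((Phi F, η) : XE)‖ ≤ r := by
  obtain ⟨B, hB⟩ := (isCompact_closedBall (0 : Mat) M).exists_bound_of_continuousOn
    continuous_Phi.continuousOn
  refine ⟨max B M, fun F η hF h0 hη => norm_prod_le_iff.2 ⟨?_, ?_⟩⟩
  · exact (hB F (by simpa using (norm_le_frob F).trans hF)).trans (le_max_left _ _)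
  · exact (Real.norm_of_nonneg h0 ▸ hη).trans (le_max_right _ _)

lemma erel_eq (eh : XE → ℝ) (x xb : XE) :
    erel eh x xb = eh x - eh xb - fderivWithin ℝ eh Dom xb (x - xb) := by
  have h : x - xb = (x.1 - xb.1, (0 : ℝ)) + (x.2 - xb.2) • ((0 : Xi), (1 : ℝ)) := by
    ext <;> simp
  rw [erel, dXi, dEta, h, map_add, map_smul, smul_eq_mul]
  ring

lemma half_mul_norm_sq_le_erel {eh : XE → ℝ} {c : ℝ} (hc : 0 ≤ c) (hC : ContDiffOn ℝ 2 eh Dom)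
    (hconv : UnifConvex eh c) {x xb : XE} (hx : x ∈ Dom) (hxb : xb ∈ Dom) :
    c * ‖x - xb‖ ^ 2 / 2 ≤ erel eh x xb := by
  rw [erel_eq]
  exact half_le_sub_sub_fderivWithin convex_Dom uniqueDiffOn_Dom hC hx hxb fun z hz =>
    (mul_le_mul_of_nonneg_left (norm_sq_le_euclidean _) hc).trans (hconv z hz _)

lemma contDiffOn_dEta {eh : XE → ℝ} (hC : ContDiffOn ℝ 3 eh Dom) :
    ContDiffOn ℝ 2 (dEta eh) Dom :=
  (hC.fderivWithin uniqueDiffOn_Dom (by norm_num)).clm_apply contDiffOn_const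

/-- A continuously differentiable function grows at most linearly when expanded to first order
at points of a bounded part of a closed set. -/
lemma exists_abs_add_fderivWithin_le {E : Type*} [NormedAddCommGroup E] [NormedSpace ℝ E]
    [ProperSpace E] {s : Set E} (hu : UniqueDiffOn ℝ s) (hcl : IsClosed s)
    {f : E → ℝ} (hf : ContDiffOn ℝ 1 f s) (r : ℝ) :
    ∃ C : ℝ, 0 ≤ C ∧ ∀ y ∈ s ∩ Metric.closedBall 0 r, ∀ x,
      |f y + fderivWithin ℝ f s y (x - y)| ≤ C * (1 + ‖x - y‖) := by
  have hk : IsCompact (s ∩ Metric.closedBall 0 r) :=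
    (isCompact_closedBall (0 : E) r).inter_left hcl
  obtain ⟨A, hA⟩ := hk.exists_bound_of_continuousOn (hf.continuousOn.mono Set.inter_subset_left)
  obtain ⟨B, hB⟩ := hk.exists_bound_of_continuousOn
    ((hf.continuousOn_fderivWithin hu le_rfl).mono Set.inter_subset_left)
  refine ⟨|A| + |B|, by positivity, fun y hy x => ?_⟩
  have h1 : |f y| ≤ |A| := (hA y hy).trans (le_abs_self A)
  have h2 : |fderivWithin ℝ f s y (x - y)| ≤ |B| * ‖x - y‖ :=
    (ContinuousLinearMap.le_opNorm _ _).trans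
      (mul_le_mul_of_nonneg_right ((hB y hy).trans (le_abs_self B)) (norm_nonneg _))
  have h3 := mul_nonneg (abs_nonneg A) (norm_nonneg (x - y))
  linarith [abs_add_le (f y) (fderivWithin ℝ f s y (x - y)), abs_nonneg B]

lemma exists_abs_relTheta_le_erel {c cg p q ρ ℓ : ℝ} {eh : XE → ℝ} (hc : 0 < c) (hcg : 0 < cg)
    (hp : 1 ≤ p) (hq : 1 ≤ q) (hρ : 1 ≤ ρ) (hℓ : 1 ≤ ℓ) (hC3 : ContDiffOn ℝ 3 eh Dom)
    (hconv : UnifConvex eh c) (hG1 : GrowthG1 eh cg p q ρ ℓ) (hG2 : GrowthG2 eh p q ρ ℓ)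
    (r : ℝ) : ∃ C > (0 : ℝ), ∀ x ∈ Dom, ∀ xb ∈ Dom ∩ Metric.closedBall 0 r,
      |relTheta eh x xb| ≤ C * erel eh x xb := by
  have hθ := contDiffOn_dEta hC3
  obtain ⟨T, hT⟩ := exists_abs_sub_sub_fderivWithin_le convex_Dom uniqueDiffOn_Dom isClosed_Dom
    hθ (r + 1)
  obtain ⟨A, hA0, hA⟩ := exists_abs_add_fderivWithin_le uniqueDiffOn_Dom isClosed_Dom
    (hθ.of_le (by norm_num)) r
  obtain ⟨B, hB0, hB⟩ := exists_abs_add_fderivWithin_le uniqueDiffOn_Dom isClosed_Dom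
    (hC3.of_le (by norm_num)) r
  obtain ⟨R, hR⟩ := hG2 1 one_pos
  obtain ⟨D, hD⟩ := ((isCompact_closedBall (0 : XE) (max 1 R)).inter_left
    isClosed_Dom).exists_bound_of_continuousOn (hθ.continuousOn.mono Set.inter_subset_left)
  set L : ℝ := |T| + 2 * A + |D| + (2 * B + cg) / cg with hL
  have hL0 : 0 ≤ L := by positivity
  refine ⟨2 * L / c + 1 / cg, by positivity, fun x hx xb hxb => ?_⟩
  have hlow := half_mul_norm_sq_le_erel hc.le (hC3.of_le (by norm_num)) hconv hx hxb.1
  have hE : ‖x - xb‖ ^ 2 ≤ 2 / c * erel eh x xb := by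
    rw [div_mul_eq_mul_div, le_div_iff₀ hc]
    linarith
  have hE0 : 0 ≤ erel eh x xb := (by positivity : 0 ≤ c * ‖x - xb‖ ^ 2 / 2).trans hlow
  suffices h : |relTheta eh x xb| ≤ L * ‖x - xb‖ ^ 2 + erel eh x xb / cg by
    have := mul_le_mul_of_nonneg_left hE hL0
    calc _ ≤ _ := h
      _ ≤ L * (2 / c * erel eh x xb) + erel eh x xb / cg := by linarith
      _ = _ := by ring
  have hEcg : 0 ≤ erel eh x xb / cg := by positivity
  have hA2 : 0 ≤ (2 * B + cg) / cg := by positivity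
  have hrel : relTheta eh x xb =
      dEta eh x - dEta eh xb - fderivWithin ℝ (dEta eh) Dom xb (x - xb) := rfl
  rw [hrel]
  rcases le_total ‖x - xb‖ 1 with hn | hn
  · have hxb' : ‖xb‖ ≤ r := by simpa using hxb.2
    have hxr : ‖x‖ ≤ r + 1 := by
      have := norm_le_norm_add_norm_sub' x xb
      linarith
    have h := hT x ⟨hx, by simpa using hxr⟩ xb ⟨hxb.1, by
      rw [mem_closedBall_zero_iff]; linarith⟩
    have hTL : T ≤ L := by
      rw [hL]
      linarith [le_abs_self T, abs_nonneg D]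
    have := mul_le_mul_of_nonneg_right hTL (sq_nonneg ‖x - xb‖)
    linarith
  · have hsq : 1 + ‖x - xb‖ ≤ 2 * ‖x - xb‖ ^ 2 := by nlinarith
    have hsq1 : 1 ≤ ‖x - xb‖ ^ 2 := by nlinarith
    have hlin : |dEta eh xb + fderivWithin ℝ (dEta eh) Dom xb (x - xb)| ≤
        2 * A * ‖x - xb‖ ^ 2 :=
      (hA xb hxb x).trans (by linarith [mul_le_mul_of_nonneg_left hsq hA0])
    have hθx : |dEta eh x| ≤
        (|D| + (2 * B + cg) / cg) * ‖x - xb‖ ^ 2 + erel eh x xb / cg := by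
      rcases le_total R (bigN p q ρ ℓ x) with hN | hN
      · have h1 := hR x hx hN
        have h2 := (hG1 x hx).1
        have h3 := (le_abs_self _).trans (hB xb hxb x)
        have h4 := erel_eq eh x xb
        have h5 := mul_le_mul_of_nonneg_left hsq hB0
        have h6 := mul_le_mul_of_nonneg_left hsq1 hcg.le
        have h7 : bigN p q ρ ℓ x ≤
            ((2 * B + cg) * ‖x - xb‖ ^ 2 + erel eh x xb) / cg := by
          rw [le_div_iff₀ hcg]
          linarith
        have h8 := mul_nonneg (abs_nonneg D) (sq_nonneg ‖x - xb‖)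
        calc _ ≤ bigN p q ρ ℓ x := by linarith
          _ ≤ _ := h7
          _ = (2 * B + cg) / cg * ‖x - xb‖ ^ 2 + erel eh x xb / cg := by ring
          _ ≤ _ := by linarith
      · have h1 : |dEta eh x| ≤ |D| :=
          (hD x ⟨hx, by simpa using norm_le_of_bigN_le hp hq hρ hℓ hN⟩).trans (le_abs_self D)
        have h2 := mul_le_mul_of_nonneg_left hsq1 (abs_nonneg D)
        have h3 := mul_nonneg hA2 (sq_nonneg ‖x - xb‖)
        linarith
    have hTn := mul_nonneg (abs_nonneg T) (sq_nonneg ‖x - xb‖)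
    rw [sub_sub, hL]
    linarith [abs_sub (dEta eh x) (dEta eh xb + fderivWithin ℝ (dEta eh) Dom xb (x - xb))]

/-- relative entropy estimate, part (II): relative temperature bound.
Under uniform convexity and (G1)–(G3), for every `M > 0` there is `C₃ > 0` with
`|θ̂(Φ(F),η | Φ(F̄),η̄)| ≤ C₃ I(v,Φ(F),η | v̄,Φ(F̄),η̄)` for all `(F,v,η)` and
`(F̄,v̄,η̄) ∈ Γ_M`. -/
theorem relative_temperature_bound
    (c cg p q ρ ℓ : ℝ) (eh : XE → ℝ)
    (hc : 0 < c) (hcg : 0 < cg)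
    (hp : 4 ≤ p) (hq : 2 ≤ q) (hρ : 1 < ρ) (hℓ : 1 < ℓ)
    (hC3 : ContDiffOn ℝ 3 eh Dom)
    (hconv : UnifConvex eh c)
    (hG1 : GrowthG1 eh cg p q ρ ℓ)
    (hG2 : GrowthG2 eh p q ρ ℓ)
    (hG3 : GrowthG3 eh cg p q ρ ℓ)
    :
    ∀ M > (0:ℝ), ∃ C₃ > (0:ℝ),
      ∀ (F Fb : Mat) (v vb : Fin 3 → ℝ) (η ηb : ℝ),
        0 ≤ η → Gam M Fb vb ηb →
        |relTheta eh (Phi F, η) (Phi Fb, ηb)|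
          ≤ C₃ * relI eh v vb (Phi F, η) (Phi Fb, ηb) := by
  intro M _
  obtain ⟨r, hr⟩ := exists_norm_Phi_le M
  obtain ⟨C, hC, h⟩ := exists_abs_relTheta_le_erel hc hcg (by linarith) (by linarith) hρ.le hℓ.le
    hC3 hconv hG1 hG2 r
  refine ⟨C, hC, fun F Fb v vb η ηb hη ⟨hF, _, h0, hM⟩ => ?_⟩
  refine (h (Phi F, η) hη (Phi Fb, ηb) ⟨h0, by simpa using hr Fb ηb hF h0 hM⟩).trans ?_
  refine mul_le_mul_of_nonneg_left ?_ hC.le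
  have : 0 ≤ ∑ i, (v i - vb i) ^ 2 := Finset.sum_nonneg fun _ _ => sq_nonneg _
  rw [relI]
  linarith
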